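/- Let B > 0 be a fixed constant. There exist constants c > 0 and k₀, depending only on B, such that for every d ≥ 2, every k ≥ k₀, and every estimator θ̂ (i.e., every function mapping the collection of comparison outcomes {W_ij} to ℝ^d), the mean squared error satisfies sup_{θ* ∈ Θ_B} E[‖θ̂ − θ*‖₂²] ≥ c/k. -/

import Mathlib

open Finset

/-- The sigmoid (logistic) function `σ(x) = 1/(1+e^{-x})`. -/
noncomputable def sigmoid (x : ℝ) : ℝ := 1 / (1 + Real.exp (-x))

/-- Probability that `Binomial(k, p) = w`. -/
noncomputable def binomProb (k : ℕ) (p : ℝ) (w : ℕ) : ℝ :=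
  (k.choose w : ℝ) * p ^ w * (1 - p) ^ (k - w)

/-- Sample space for the league format: for each pair `i < j`, the number of wins
of item `i` over item `j` among the `k` comparisons of that pair. -/
abbrev BTLOutcome (d k : ℕ) := {q : Fin d × Fin d // q.1 < q.2} → Fin (k + 1)

/-- Joint probability of an outcome: independent `Binomial(k, σ(θ_i - θ_j))`
win counts across the pairs `i < j`. -/
noncomputable def outcomeProb (d k : ℕ) (θ : Fin d → ℝ) (w : BTLOutcome d k) : ℝ :=
  ∏ q : {q : Fin d × Fin d // q.1 < q.2},
    binomProb k (sigmoid (θ q.1.1 - θ q.1.2)) (w q : ℕ)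

/-- The full win-count matrix `W_ij` determined by an outcome (`W_ji = k - W_ij`). -/
def winCount (d k : ℕ) (w : BTLOutcome d k) (i j : Fin d) : ℕ :=
  if h : i < j then (w ⟨(i, j), h⟩ : ℕ)
  else if h' : j < i then k - (w ⟨(j, i), h'⟩ : ℕ)
  else 0

/-- The observed fraction of wins `μ_ij = W_ij / k`. -/
noncomputable def winFrac (d k : ℕ) (w : BTLOutcome d k) (i j : Fin d) : ℝ :=
  (winCount d k w i j : ℝ) / (k : ℝ)

/-- The negative log-likelihood
`ℓ(θ) = k ∑_{i<j} [log(e^{θ_i}+e^{θ_j}) - μ_ij θ_i - μ_ji θ_j]`. -/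
noncomputable def nll (d k : ℕ) (μ : Fin d → Fin d → ℝ) (θ : Fin d → ℝ) : ℝ :=
  (k : ℝ) * ∑ i : Fin d, ∑ j : Fin d,
    if i < j then
      Real.log (Real.exp (θ i) + Real.exp (θ j)) - μ i j * θ i - μ j i * θ j
    else 0

/-- The parameter domain `Θ_B = {θ : ‖θ‖_∞ ≤ B, ∑ θ_i = 0}`
(the norm on `Fin d → ℝ` is the sup norm). -/
def paramSet (d : ℕ) (B : ℝ) : Set (Fin d → ℝ) :=
  {θ | ‖θ‖ ≤ B ∧ ∑ i, θ i = 0}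

/-- The expectation (under true parameter `θ*`) of an estimator. -/
noncomputable def expVec (d k : ℕ) (θstar : Fin d → ℝ)
    (est : BTLOutcome d k → Fin d → ℝ) : Fin d → ℝ :=
  fun m => ∑ w : BTLOutcome d k, outcomeProb d k θstar w * est w m

/-- The Hellinger affinity of the Bernoulli laws with success probabilities `p` and `q`. -/
noncomputable def bernoulliAffinity (p q : ℝ) : ℝ :=
  √(p * q) + √((1 - p) * (1 - q))

theorem sigmoid_pos (x : ℝ) : 0 < sigmoid x := by
  unfold sigmoid
  positivity

theorem one_sub_sigmoid (x : ℝ) : 1 - sigmoid x = Real.exp (-x) / (1 + Real.exp (-x)) := by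
  unfold sigmoid
  field_simp
  ring

theorem sigmoid_le_one (x : ℝ) : sigmoid x ≤ 1 := by
  have h : 0 ≤ 1 - sigmoid x := by
    rw [one_sub_sigmoid]
    positivity
  linarith

theorem bernoulliAffinity_self {p : ℝ} (h0 : 0 ≤ p) (h1 : p ≤ 1) : bernoulliAffinity p p = 1 := by
  rw [bernoulliAffinity, Real.sqrt_mul_self h0, Real.sqrt_mul_self (by linarith)]
  ring

theorem exp_neg_sq_le_bernoulliAffinity (x y : ℝ) :
    Real.exp (-(x - y) ^ 2 / 32) ≤ bernoulliAffinity (sigmoid x) (sigmoid y) := by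
  set a := Real.exp (-x / 2) with ha
  set b := Real.exp (-y / 2) with hb
  set n := √((1 + a ^ 2) * (1 + b ^ 2)) with hn
  have ha0 : 0 < a := Real.exp_pos _
  have hb0 : 0 < b := Real.exp_pos _
  have hn0 : 0 < n := Real.sqrt_pos.2 (by positivity)
  have hn2 : n ^ 2 = (1 + a ^ 2) * (1 + b ^ 2) := Real.sq_sqrt (by positivity)
  have hxa : Real.exp (-x) = a ^ 2 := by
    rw [ha, ← Real.exp_nat_mul]
    congr 1
    push_cast
    ring
  have hyb : Real.exp (-y) = b ^ 2 := by
    rw [hb, ← Real.exp_nat_mul]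
    congr 1
    push_cast
    ring
  have hpq : √(sigmoid x * sigmoid y) = 1 / n := by
    rw [Real.sqrt_eq_iff_mul_self_eq_of_pos (by positivity), ← sq, div_pow, hn2, sigmoid, sigmoid, hxa, hyb]
    field_simp
  have hpq' : √((1 - sigmoid x) * (1 - sigmoid y)) = a * b / n := by
    rw [Real.sqrt_eq_iff_mul_self_eq_of_pos (by positivity), ← sq, div_pow, hn2, one_sub_sigmoid, one_sub_sigmoid,
      hxa, hyb]
    field_simp
  set c := Real.cosh ((x - y) / 4) with hc
  have hc0 : 0 < c := Real.cosh_pos _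
  have hc2 : c ^ 2 * (4 * (a * b)) = (a + b) ^ 2 := by
    set u := Real.exp (-x / 4) with hu
    set v := Real.exp (-y / 4) with hv
    have hu0 : 0 < u := Real.exp_pos _
    have hv0 : 0 < v := Real.exp_pos _
    have hau : a = u ^ 2 := by
      rw [ha, hu, ← Real.exp_nat_mul]
      congr 1
      push_cast
      ring
    have hbv : b = v ^ 2 := by
      rw [hb, hv, ← Real.exp_nat_mul]
      congr 1
      push_cast
      ring
    have h1 : Real.exp ((x - y) / 4) = v / u := by
      rw [hv, hu, ← Real.exp_sub]
      congr 1
      ring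
    have h2 : Real.exp (-((x - y) / 4)) = u / v := by
      rw [Real.exp_neg, h1, inv_div]
    rw [hc, Real.cosh_eq, h1, h2, hau, hbv]
    field_simp
    ring
  have hkey : n ≤ c * (1 + a * b) := by
    refine le_of_sq_le_sq ?_ (by positivity)
    refine le_of_mul_le_mul_right ?_ (show 0 < 4 * (a * b) by positivity)
    calc n ^ 2 * (4 * (a * b)) ≤ (a + b) ^ 2 * (1 + a * b) ^ 2 := by
          rw [hn2]
          linarith [mul_nonneg (sq_nonneg (a - b)) (sq_nonneg (1 - a * b))]
      _ = (c * (1 + a * b)) ^ 2 * (4 * (a * b)) := by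
          rw [← hc2]
          ring
  have hcexp : c * Real.exp (-(x - y) ^ 2 / 32) ≤ 1 := by
    have h := Real.cosh_le_exp_half_sq ((x - y) / 4)
    calc c * Real.exp (-(x - y) ^ 2 / 32)
        ≤ Real.exp (((x - y) / 4) ^ 2 / 2) * Real.exp (-(x - y) ^ 2 / 32) := by gcongr
      _ = 1 := by
          rw [← Real.exp_add, Real.exp_eq_one_iff]
          ring
  rw [bernoulliAffinity, hpq, hpq', ← add_div, le_div_iff₀ hn0]
  calc Real.exp (-(x - y) ^ 2 / 32) * n
      ≤ Real.exp (-(x - y) ^ 2 / 32) * (c * (1 + a * b)) := by gcongr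
    _ = (c * Real.exp (-(x - y) ^ 2 / 32)) * (1 + a * b) := by ring
    _ ≤ 1 * (1 + a * b) := by gcongr
    _ = 1 + a * b := one_mul _

theorem binomProb_nonneg (k : ℕ) {p : ℝ} (h0 : 0 ≤ p) (h1 : p ≤ 1) (w : ℕ) :
    0 ≤ binomProb k p w := by
  have : 0 ≤ 1 - p := by linarith
  unfold binomProb
  positivity

theorem sum_sqrt_binomProb_mul (k : ℕ) {p q : ℝ} (hp0 : 0 ≤ p) (hp1 : p ≤ 1) (hq0 : 0 ≤ q)
    (hq1 : q ≤ 1) :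
    ∑ w : Fin (k + 1), √(binomProb k p w * binomProb k q w) = bernoulliAffinity p q ^ k := by
  have h1 : 0 ≤ p * q := mul_nonneg hp0 hq0
  have h2 : 0 ≤ (1 - p) * (1 - q) := mul_nonneg (by linarith) (by linarith)
  rw [bernoulliAffinity, add_pow,
    Fin.sum_univ_eq_sum_range (fun w => √(binomProb k p w * binomProb k q w))]
  refine Finset.sum_congr rfl fun w _ => ?_
  rw [Real.sqrt_eq_iff_mul_self_eq
    (mul_nonneg (binomProb_nonneg k hp0 hp1 w) (binomProb_nonneg k hq0 hq1 w)) (by positivity)]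
  unfold binomProb
  have e1 : √(p * q) ^ w * √(p * q) ^ w = p ^ w * q ^ w := by
    rw [← mul_pow, Real.mul_self_sqrt h1, mul_pow]
  have e2 : √((1 - p) * (1 - q)) ^ (k - w) * √((1 - p) * (1 - q)) ^ (k - w)
      = (1 - p) ^ (k - w) * (1 - q) ^ (k - w) := by
    rw [← mul_pow, Real.mul_self_sqrt h2, mul_pow]
  linear_combination -(k.choose w : ℝ) ^ 2 * (√((1 - p) * (1 - q)) ^ (k - w)) ^ 2 * e1 -
    (k.choose w : ℝ) ^ 2 * (p ^ w * q ^ w) * e2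

theorem outcomeProb_nonneg (d k : ℕ) (θ : Fin d → ℝ) (w : BTLOutcome d k) :
    0 ≤ outcomeProb d k θ w :=
  Finset.prod_nonneg fun _ _ => binomProb_nonneg k (sigmoid_pos _).le (sigmoid_le_one _) _

theorem sum_sqrt_outcomeProb_mul (d k : ℕ) (θ η : Fin d → ℝ) :
    ∑ w : BTLOutcome d k, √(outcomeProb d k θ w * outcomeProb d k η w) =
      ∏ q : {q : Fin d × Fin d // q.1 < q.2},
        bernoulliAffinity (sigmoid (θ q.1.1 - θ q.1.2)) (sigmoid (η q.1.1 - η q.1.2)) ^ k := by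
  simp_rw [← sum_sqrt_binomProb_mul k (sigmoid_pos _).le (sigmoid_le_one _) (sigmoid_pos _).le
    (sigmoid_le_one _), Fintype.prod_sum]
  refine Finset.sum_congr rfl fun w _ => ?_
  rw [outcomeProb, outcomeProb, ← Finset.prod_mul_distrib, Real.sqrt_prod]
  exact fun _ _ => mul_nonneg (binomProb_nonneg k (sigmoid_pos _).le (sigmoid_le_one _) _)
    (binomProb_nonneg k (sigmoid_pos _).le (sigmoid_le_one _) _)

theorem sum_outcomeProb (d k : ℕ) (θ : Fin d → ℝ) :
    ∑ w : BTLOutcome d k, outcomeProb d k θ w = 1 := by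
  have h := sum_sqrt_outcomeProb_mul d k θ θ
  simp only [Real.sqrt_mul_self (outcomeProb_nonneg d k θ _),
    bernoulliAffinity_self (sigmoid_pos _).le (sigmoid_le_one _), one_pow,
    Finset.prod_const_one] at h
  exact h

theorem sum_lt_sq_sub_le {d : ℕ} (h : Fin d → ℝ) :
    ∑ q : {q : Fin d × Fin d // q.1 < q.2}, (h q.1.1 - h q.1.2) ^ 2 ≤ d * ∑ i, h i ^ 2 := by
  have hsub : ∑ q : {q : Fin d × Fin d // q.1 < q.2}, (h q.1.1 - h q.1.2) ^ 2
      = ∑ i, ∑ j, if i < j then (h i - h j) ^ 2 else 0 := by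
    rw [← Fintype.sum_prod_type', ← Finset.sum_filter]
    exact (Finset.sum_subtype _ (by simp) (fun q : Fin d × Fin d => (h q.1 - h q.2) ^ 2)).symm
  have hswap : ∑ i, ∑ j, (if i < j then (h i - h j) ^ 2 else 0)
      = ∑ i, ∑ j, if j < i then (h i - h j) ^ 2 else 0 := by
    rw [Finset.sum_comm]
    refine Finset.sum_congr rfl fun i _ => Finset.sum_congr rfl fun j _ => ?_
    split_ifs
    · ring
    · rfl
  have hfull : ∑ i, ∑ j, (if i < j then (h i - h j) ^ 2 else 0)
      + ∑ i, ∑ j, (if j < i then (h i - h j) ^ 2 else 0) = ∑ i, ∑ j, (h i - h j) ^ 2 := by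
    simp only [← Finset.sum_add_distrib]
    refine Finset.sum_congr rfl fun i _ => Finset.sum_congr rfl fun j _ => ?_
    rcases lt_trichotomy i j with hij | rfl | hij
    · simp [hij, hij.not_gt]
    · simp
    · simp [hij, hij.not_gt]
  have hexp : ∑ i, ∑ j, (h i - h j) ^ 2 = 2 * (d * ∑ i, h i ^ 2) - 2 * (∑ i, h i) ^ 2 := by
    simp only [sub_sq, Finset.sum_add_distrib, Finset.sum_sub_distrib, ← Finset.mul_sum,
      ← Finset.sum_mul, Finset.sum_const, Finset.card_univ, Fintype.card_fin, nsmul_eq_mul]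
    ring
  rw [hsub]
  linarith [sq_nonneg (∑ i, h i)]

theorem exp_neg_le_sum_sqrt_outcomeProb_mul (d k : ℕ) (θ η : Fin d → ℝ) (c : ℝ) :
    Real.exp (-(k * (d * ∑ i, (θ i - η i - c) ^ 2) / 32)) ≤
      ∑ w : BTLOutcome d k, √(outcomeProb d k θ w * outcomeProb d k η w) := by
  rw [sum_sqrt_outcomeProb_mul]
  calc Real.exp (-(k * (d * ∑ i, (θ i - η i - c) ^ 2) / 32))
      ≤ Real.exp (-(k * (∑ q : {q : Fin d × Fin d // q.1 < q.2},
          ((θ q.1.1 - η q.1.1 - c) - (θ q.1.2 - η q.1.2 - c)) ^ 2) / 32)) := by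
        gcongr
        exact sum_lt_sq_sub_le fun i => θ i - η i - c
    _ = ∏ q : {q : Fin d × Fin d // q.1 < q.2},
          Real.exp (-((θ q.1.1 - θ q.1.2) - (η q.1.1 - η q.1.2)) ^ 2 / 32) ^ k := by
        simp only [← Real.exp_nat_mul]
        rw [← Real.exp_sum, Finset.mul_sum, Finset.sum_div, ← Finset.sum_neg_distrib]
        congr 1
        refine Finset.sum_congr rfl fun q _ => ?_
        ring
    _ ≤ _ := by
        gcongr
        exact exp_neg_sq_le_bernoulliAffinity _ _

theorem sq_mul_le_of_sq_weights (r s u v l : ℝ) :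
    (u + v) ^ 2 * (2 * l * (r * s) - l ^ 2 * (r ^ 2 + s ^ 2)) ≤ r ^ 2 * u ^ 2 + s ^ 2 * v ^ 2 := by
  rcases (add_nonneg (sq_nonneg r) (sq_nonneg s)).eq_or_lt with h | h
  · have hr : r = 0 := by nlinarith [sq_nonneg r, sq_nonneg s]
    have hs : s = 0 := by nlinarith [sq_nonneg r, sq_nonneg s]
    simp [hr, hs]
  · refine le_of_mul_le_mul_left ?_ h
    have h1 : (r * s) ^ 2 * (u + v) ^ 2
        ≤ (r ^ 2 + s ^ 2) * (r ^ 2 * u ^ 2 + s ^ 2 * v ^ 2) := by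
      linarith [sq_nonneg (r ^ 2 * u - s ^ 2 * v)]
    have h2 := mul_nonneg (sq_nonneg (u + v)) (sq_nonneg (r * s - l * (r ^ 2 + s ^ 2)))
    linarith

/-- Le Cam's two-point bound for the squared error, in terms of the Hellinger affinity. -/
theorem two_point_lower_bound {Ω : Type*} [Fintype Ω] {P Q : Ω → ℝ} (hP : ∀ w, 0 ≤ P w)
    (hQ : ∀ w, 0 ≤ Q w) (hP1 : ∑ w, P w = 1) (hQ1 : ∑ w, Q w = 1) (x : Ω → ℝ) (a b : ℝ) :
    (a - b) ^ 2 * (∑ w, √(P w * Q w)) ^ 2 / 2 ≤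
      ∑ w, P w * (x w - a) ^ 2 + ∑ w, Q w * (x w - b) ^ 2 := by
  set ρ := ∑ w, √(P w * Q w) with hρ
  calc (a - b) ^ 2 * ρ ^ 2 / 2
      = ∑ w, (a - b) ^ 2 * (2 * (ρ / 2) * √(P w * Q w) - (ρ / 2) ^ 2 * (P w + Q w)) := by
        rw [← Finset.mul_sum, Finset.sum_sub_distrib, ← Finset.mul_sum, ← Finset.mul_sum,
          Finset.sum_add_distrib, hP1, hQ1, ← hρ]
        ring
    _ ≤ ∑ w, (P w * (x w - a) ^ 2 + Q w * (x w - b) ^ 2) := by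
        refine Finset.sum_le_sum fun w _ => ?_
        have h := sq_mul_le_of_sq_weights √(P w) √(Q w) (x w - a) (b - x w) (ρ / 2)
        rw [Real.sq_sqrt (hP w), Real.sq_sqrt (hQ w), ← Real.sqrt_mul (hP w)] at h
        linarith
    _ = _ := Finset.sum_add_distrib

/-- The centred hypercube vertex `δ (s - mean s)` with `s i = 1` if `v i` and `s i = -1`
otherwise. -/
noncomputable def cubeParam {d : ℕ} (δ : ℝ) (v : Fin d → Bool) (i : Fin d) : ℝ :=
  δ * ((if v i then 1 else -1) - (∑ j, if v j then 1 else -1) / d)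

theorem abs_sum_sign_le {d : ℕ} (v : Fin d → Bool) :
    |∑ j, (if v j then (1 : ℝ) else -1)| ≤ d := by
  refine (Finset.abs_sum_le_sum_abs _ _).trans ?_
  calc ∑ j, |if v j then (1 : ℝ) else -1| ≤ ∑ _j : Fin d, (1 : ℝ) :=
        Finset.sum_le_sum fun j _ => by split_ifs <;> simp
    _ = d := by simp

theorem cubeParam_mem_paramSet {d : ℕ} (hd : 0 < d) {δ B : ℝ} (hδ : 0 ≤ δ) (hδB : 2 * δ ≤ B)
    (v : Fin d → Bool) : cubeParam δ v ∈ paramSet d B := by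
  have hd' : (0 : ℝ) < d := by exact_mod_cast hd
  refine ⟨(pi_norm_le_iff_of_nonneg (by linarith)).2 fun i => ?_, ?_⟩
  · have h1 : |(∑ j, if v j then (1 : ℝ) else -1) / d| ≤ 1 := by
      rw [abs_div, Nat.abs_cast, div_le_one hd']
      exact abs_sum_sign_le v
    have h2 : |if v i then (1 : ℝ) else -1| ≤ 1 := by split_ifs <;> simp
    rw [Real.norm_eq_abs, cubeParam, abs_mul, abs_of_nonneg hδ]
    calc δ * |(if v i then (1 : ℝ) else -1) - (∑ j, if v j then (1 : ℝ) else -1) / d|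
        ≤ δ * (1 + 1) := by
          gcongr
          exact (abs_sub _ _).trans (add_le_add h2 h1)
      _ ≤ B := by linarith
  · simp only [cubeParam, ← Finset.mul_sum, Finset.sum_sub_distrib, Finset.sum_const,
      Finset.card_univ, Fintype.card_fin, nsmul_eq_mul]
    field_simp
    ring

theorem cubeParam_sub_flip {d : ℕ} (δ : ℝ) (v : Fin d → Bool) (i : Fin d) :
    ∃ ε : ℝ, ε ^ 2 = 4 ∧ ∀ j, cubeParam δ v j - cubeParam δ (Function.update v i (!v i)) j =
      δ * ε * ((if j = i then 1 else 0) - 1 / d) := by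
  set ε : ℝ := 2 * if v i then 1 else -1 with hε
  have hj : ∀ j, (if v j then (1 : ℝ) else -1)
      - (if Function.update v i (!v i) j then 1 else -1) = if j = i then ε else 0 := by
    intro j
    rcases eq_or_ne j i with rfl | h
    · rw [Function.update_self, if_pos rfl, hε]
      cases v j <;> norm_num
    · simp [h]
  have hsum : (∑ j, if v j then (1 : ℝ) else -1)
      - (∑ j, if Function.update v i (!v i) j then (1 : ℝ) else -1) = ε := by
    rw [← Finset.sum_sub_distrib]
    simp only [hj]
    simp
  refine ⟨ε, ?_, fun j => ?_⟩
  · rw [hε]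
    split_ifs <;> norm_num
  · have h := hj j
    have h' : (if j = i then ε else 0) = ε * if j = i then 1 else 0 := by simp
    rw [h'] at h
    unfold cubeParam
    linear_combination δ * h - δ / d * hsum

theorem coordinate_two_point_bound {d : ℕ} (hd : 2 ≤ d) (k : ℕ) (δ : ℝ) (v : Fin d → Bool)
    (i : Fin d) (x : BTLOutcome d k → ℝ) :
    δ ^ 2 * Real.exp (-(k * d * δ ^ 2 / 4)) / 2 ≤
      ∑ w, outcomeProb d k (cubeParam δ v) w * (x w - cubeParam δ v i) ^ 2 +
      ∑ w, outcomeProb d k (cubeParam δ (Function.update v i (!v i))) w *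
        (x w - cubeParam δ (Function.update v i (!v i)) i) ^ 2 := by
  obtain ⟨ε, hε, hdiff⟩ := cubeParam_sub_flip δ v i
  have hd' : (2 : ℝ) ≤ d := by exact_mod_cast hd
  refine le_trans ?_ (two_point_lower_bound (outcomeProb_nonneg d k _) (outcomeProb_nonneg d k _)
    (sum_outcomeProb d k _) (sum_outcomeProb d k _) x _ _)
  have haff := exp_neg_le_sum_sqrt_outcomeProb_mul d k (cubeParam δ v)
    (cubeParam δ (Function.update v i (!v i))) (-(δ * ε / d))
  have hsq : ∑ j, (cubeParam δ v j - cubeParam δ (Function.update v i (!v i)) j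
      - -(δ * ε / d)) ^ 2 = 4 * δ ^ 2 := by
    have : ∀ j, (cubeParam δ v j - cubeParam δ (Function.update v i (!v i)) j
        - -(δ * ε / d)) ^ 2 = if j = i then 4 * δ ^ 2 else 0 := by
      intro j
      rw [hdiff]
      split_ifs
      · linear_combination δ ^ 2 * hε
      · ring
    simp only [this]
    simp
  rw [hsq] at haff
  have hexp : Real.exp (-(k * d * δ ^ 2 / 4)) = Real.exp (-(k * (d * (4 * δ ^ 2)) / 32)) ^ 2 := by
    rw [← Real.exp_nat_mul]
    congr 1
    push_cast
    ring
  have hcoord : δ ^ 2 ≤ (cubeParam δ v i - cubeParam δ (Function.update v i (!v i)) i) ^ 2 := by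
    have hinv : 1 / (d : ℝ) ≤ 1 / 2 := one_div_le_one_div_of_le two_pos hd'
    rw [hdiff, if_pos rfl, mul_pow, mul_pow, hε]
    have : (1 / 2 : ℝ) ^ 2 ≤ (1 - 1 / d) ^ 2 := by
      gcongr
      linarith
    nlinarith [sq_nonneg δ]
  rw [hexp]
  gcongr

/-- Assouad's argument: the average risk over the hypercube. -/
theorem average_risk_lower_bound {d : ℕ} (hd : 2 ≤ d) (k : ℕ) (δ : ℝ)
    (est : BTLOutcome d k → Fin d → ℝ) :
    ∑ _v : Fin d → Bool, d * (δ ^ 2 * Real.exp (-(k * d * δ ^ 2 / 4)) / 4) ≤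
      ∑ v : Fin d → Bool, ∑ w, outcomeProb d k (cubeParam δ v) w *
        ∑ i, (est w i - cubeParam δ v i) ^ 2 := by
  set m := δ ^ 2 * Real.exp (-(k * d * δ ^ 2 / 4)) / 2 with hm
  let A : Fin d → (Fin d → Bool) → ℝ := fun i v =>
    ∑ w, outcomeProb d k (cubeParam δ v) w * (est w i - cubeParam δ v i) ^ 2
  have hrisk : ∑ v : Fin d → Bool, ∑ w, outcomeProb d k (cubeParam δ v) w *
      ∑ i, (est w i - cubeParam δ v i) ^ 2 = ∑ i, ∑ v, A i v := by
    refine (Finset.sum_congr rfl fun v _ => ?_).trans Finset.sum_comm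
    simp only [A, Finset.mul_sum]
    exact Finset.sum_comm
  have hflip : ∀ i, ∑ v, A i (Function.update v i (!v i)) = ∑ v, A i v := fun i => by
    have hinv : Function.Involutive fun v : Fin d → Bool => Function.update v i (!v i) := by
      intro v
      simp
    exact Equiv.sum_comp hinv.toPerm (A i)
  have hcoord : ∀ i, ∑ _v : Fin d → Bool, m / 2 ≤ ∑ v, A i v := fun i => by
    have h : ∑ _v : Fin d → Bool, m ≤ ∑ v, (A i v + A i (Function.update v i (!v i))) :=
      Finset.sum_le_sum fun v _ => coordinate_two_point_bound hd k δ v i fun w => est w i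
    rw [Finset.sum_add_distrib, hflip] at h
    rw [← Finset.sum_div]
    linarith
  rw [hrisk]
  calc ∑ _v : Fin d → Bool, d * (δ ^ 2 * Real.exp (-(k * d * δ ^ 2 / 4)) / 4)
      = ∑ _i : Fin d, ∑ _v : Fin d → Bool, m / 2 := by
        simp only [Finset.sum_const, Finset.card_univ, Fintype.card_fin, nsmul_eq_mul, hm]
        ring
    _ ≤ _ := Finset.sum_le_sum fun i _ => hcoord i

/-- Theorem 2(a), minimax lower bound on the mean squared error:
for every `B > 0` there are constants `c > 0` and `k₀` depending only on `B` such
that for every `d ≥ 2`, `k ≥ k₀` and *every* estimator `est` (an arbitrary function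
of the comparison outcomes), `sup_{θ* ∈ Θ_B} E[‖est − θ*‖₂²] ≥ c/k`
(witnessed by some `θ* ∈ Θ_B`). -/
theorem mse_minimax_lower_bound (B : ℝ) (hB : 0 < B) :
    ∃ c > (0 : ℝ), ∃ k₀ : ℕ, ∀ d k : ℕ, 2 ≤ d → k₀ ≤ k →
      ∀ est : BTLOutcome d k → Fin d → ℝ,
        ∃ θstar ∈ paramSet d B,
          c / (k : ℝ) ≤
            ∑ w : BTLOutcome d k,
              outcomeProb d k θstar w * ∑ i, (est w i - θstar i) ^ 2 := by
  set a := min 1 (B / 2) with ha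
  have ha0 : 0 < a := lt_min one_pos (by linarith)
  have ha1 : a ≤ 1 := min_le_left _ _
  have haB : a ≤ B / 2 := min_le_right _ _
  refine ⟨a ^ 2 * Real.exp (-1) / 4, by positivity, 1, fun d k hd hk est => ?_⟩
  have hd0 : (0 : ℝ) < d := by exact_mod_cast (by omega : 0 < d)
  have hk0 : (0 : ℝ) < k := by exact_mod_cast hk
  have hkd1 : (1 : ℝ) ≤ k * d := by exact_mod_cast Nat.mul_pos hk (by omega : 0 < d)
  set δ := a / √(k * d) with hδ
  have hδ0 : 0 ≤ δ := by positivity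
  have hδa : δ ≤ a := div_le_self ha0.le (Real.one_le_sqrt.2 hkd1)
  have hδ2 : k * d * δ ^ 2 = a ^ 2 := by
    rw [hδ, div_pow, Real.sq_sqrt (by positivity)]
    field_simp
  obtain ⟨v, -, hv⟩ := Finset.exists_le_of_sum_le Finset.univ_nonempty
    (average_risk_lower_bound hd k δ est)
  refine ⟨cubeParam δ v, cubeParam_mem_paramSet (by omega) hδ0 (by linarith) v, le_trans ?_ hv⟩
  rw [hδ2, div_le_iff₀ hk0]
  have hexp : Real.exp (-1) ≤ Real.exp (-(a ^ 2 / 4)) := by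
    gcongr
    nlinarith
  calc a ^ 2 * Real.exp (-1) / 4 ≤ a ^ 2 * Real.exp (-(a ^ 2 / 4)) / 4 := by gcongr
    _ = d * (δ ^ 2 * Real.exp (-(a ^ 2 / 4)) / 4) * k := by
        rw [← hδ2]
        ring
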